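/- For every n ≥ 1, det H_n^1(g) ≡ 1 (mod 2), where g is the ruler function g(n) = ν₂(2n). -/

import Mathlib

/-- The Hankel matrix `H_n^p(u)` of a sequence `u`: the `n × n` matrix whose
`(i, j)` entry (for `1 ≤ i, j ≤ n`) is `u (p + i + j - 2)`. -/
def hankelMatrix (n p : ℕ) (u : ℕ → ℤ) : Matrix (Fin n) (Fin n) ℤ :=
  Matrix.of fun i j => u (p + i + j)

/-- The ruler function `g(n) = ν₂(2n)`. -/
def ruler (n : ℕ) : ℤ := (padicValNat 2 (2 * n) : ℤ)

open PowerSeries in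
noncomputable def rulF : (ZMod 2)⟦X⟧ := PowerSeries.mk fun n => ((ruler (n + 1) : ℤ) : ZMod 2)

open PowerSeries in
noncomputable def rulT : (ZMod 2)⟦X⟧ := 1 + (1 + X) * rulF

open PowerSeries in
noncomputable def rulL (i j : ℕ) : ZMod 2 := coeff i (rulF * rulT ^ j)

theorem ruler_even (m : ℕ) (hm : m ≠ 0) : ruler (2 * m) = ruler m + 1 := by
  unfold ruler
  rw [padicValNat.mul (by norm_num) (by omega)]
  simp [add_comm]

theorem ruler_odd (m : ℕ) : ruler (2 * m + 1) = 1 := by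
  unfold ruler
  rw [padicValNat.mul (by norm_num) (by omega)]
  rw [padicValNat.eq_zero_of_not_dvd (n := 2 * m + 1) (by omega)]
  simp

open PowerSeries in
theorem rulTwo : (2 : (ZMod 2)⟦X⟧) = 0 := by
  have : (2 : (ZMod 2)⟦X⟧) = C (2 : ZMod 2) := (map_ofNat C 2).symm
  rw [this, show (2 : ZMod 2) = 0 from rfl, map_zero]

open PowerSeries in
theorem rulSq : rulF ^ 2 = expand 2 two_ne_zero rulF := by
  have h := MvPowerSeries.map_frobenius_expand (σ := Unit) (R := ZMod 2) 2 two_ne_zero (f := rulF)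
  have e : frobenius (ZMod 2) 2 = RingHom.id _ := ZMod.frobenius_zmod 2
  rw [e] at h
  refine Eq.trans h.symm ?_
  simp [expand]

open PowerSeries in
theorem rulEq : rulF = mk 1 + X * rulF ^ 2 := by
  rw [rulSq]
  ext n
  rcases n with _ | n
  · have := ruler_odd 0
    simp at this
    simp [rulF, this]
  · rw [map_add, coeff_succ_X_mul, coeff_expand]
    rcases Nat.even_or_odd' n with ⟨m, rfl | rfl⟩
    · have := ruler_even (m + 1) (by omega)
      rw [mul_add] at this
      simp only [mul_one] at this
      simp [rulF, add_assoc, this, add_comm (1 : ZMod 2)]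
    · have := ruler_odd (m + 1)
      rw [mul_add] at this
      rw [if_neg (by omega)]
      simp [rulF, this]

open PowerSeries in
theorem rulQuad : (1 + X) * (X * rulF ^ 2 + rulF) = 1 := by
  have h := mk_one_mul_one_sub_eq_one (ZMod 2)
  linear_combination h + (1 + X) * rulEq + (X * mk 1 + (1 + X) * X * rulF ^ 2) * rulTwo

open PowerSeries in
theorem rulT_eq : rulT = X * (1 + rulT + rulT ^ 2) := by
  have h := rulQuad
  have h2 := rulTwo
  unfold rulT
  linear_combination (-(1 + X)) * h + (rulF - 2 * X - X ^ 2 * rulF) * h2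

open PowerSeries in
theorem rulF_eq : rulF = 1 + X * (rulF * rulT ^ 1) := by
  have h := rulQuad
  have h2 := rulTwo
  unfold rulT
  linear_combination (-1) * h + (rulF - 1) * h2

theorem rulL_zero_zero : rulL 0 0 = 1 := by
  have := ruler_odd 0
  simp at this
  simp [rulL, rulF, this]

theorem rulL_zero_succ (j : ℕ) : rulL 0 (j + 1) = 0 := by
  unfold rulL
  rw [pow_succ, rulT_eq, show ∀ a b c : PowerSeries (ZMod 2), a * (b * (PowerSeries.X * c))
    = PowerSeries.X * (a * b * c) by intros; ring, PowerSeries.coeff_zero_X_mul]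

theorem rulL_succ_zero (i : ℕ) : rulL (i + 1) 0 = rulL i 1 := by
  unfold rulL
  conv_lhs => rw [pow_zero, mul_one, rulF_eq]
  rw [map_add, PowerSeries.coeff_succ_X_mul]
  simp [PowerSeries.coeff_one]

theorem rulL_succ_succ (i j : ℕ) :
    rulL (i + 1) (j + 1) = rulL i j + rulL i (j + 1) + rulL i (j + 2) := by
  unfold rulL
  rw [← map_add, ← map_add, ← PowerSeries.coeff_succ_X_mul i]
  refine congrArg _ ?_
  linear_combination (rulF * rulT ^ j) * rulT_eq

theorem rulL_lt (i : ℕ) : ∀ j, i < j → rulL i j = 0 := by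
  induction i with
  | zero =>
    intro j hj
    obtain ⟨k, rfl⟩ : ∃ k, j = k + 1 := ⟨j - 1, by omega⟩
    exact rulL_zero_succ k
  | succ i ih =>
    intro j hj
    obtain ⟨k, rfl⟩ : ∃ k, j = k + 1 := ⟨j - 1, by omega⟩
    rw [rulL_succ_succ, ih _ (by omega), ih _ (by omega), ih _ (by omega)]
    simp

theorem rulL_diag (i : ℕ) : rulL i i = 1 := by
  induction i with
  | zero => exact rulL_zero_zero
  | succ i ih =>
    rw [rulL_succ_succ, ih, rulL_lt _ _ (by omega), rulL_lt _ _ (by omega)]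
    simp

theorem rulL_sum_shift (i j M : ℕ) :
    ∑ k ∈ Finset.range (M + 1), rulL (i + 1) k * rulL j k
      = ∑ k ∈ Finset.range (M + 1), rulL i k * rulL (j + 1) k
        + rulL i (M + 1) * rulL j M - rulL i M * rulL j (M + 1) := by
  induction M with
  | zero =>
    simp [rulL_succ_zero]
  | succ M ih =>
    rw [Finset.sum_range_succ, ih, Finset.sum_range_succ _ (M + 1), rulL_succ_succ,
      rulL_succ_succ]
    ring

theorem rulL_sum (i : ℕ) : ∀ j N, i < N →
    ∑ k ∈ Finset.range N, rulL i k * rulL j k = rulL (i + j) 0 := by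
  induction i with
  | zero =>
    intro j N hN
    obtain ⟨k, rfl⟩ : ∃ k, N = k + 1 := ⟨N - 1, by omega⟩
    rw [Finset.sum_range_succ']
    simp [rulL_zero_succ, rulL_zero_zero]
  | succ i ih =>
    intro j N hN
    obtain ⟨k, rfl⟩ : ∃ k, N = k + 1 := ⟨N - 1, by omega⟩
    rw [rulL_sum_shift, ih _ _ (by omega), rulL_lt i _ (by omega), rulL_lt i k (by omega)]
    rw [show i + (j + 1) = i + 1 + j by omega]
    simp

theorem det_hankel_ruler_odd (n : ℕ) (hn : 1 ≤ n) :
    (hankelMatrix n 1 ruler).det ≡ 1 [ZMOD 2] := by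
  refine (ZMod.intCast_eq_intCast_iff _ _ 2).1 ?_
  let A : Matrix (Fin n) (Fin n) (ZMod 2) := Matrix.of fun i k => rulL i k
  have hA : A.det = 1 := by
    rw [Matrix.det_of_isLowerTriangular]
    · simp [A, rulL_diag]
    · intro i j h
      exact rulL_lt _ _ h
  have hH : (hankelMatrix n 1 ruler).map (Int.castRingHom (ZMod 2)) = A * A.transpose := by
    ext i j
    rw [Matrix.mul_apply]
    have := rulL_sum i j n i.2
    rw [← Fin.sum_univ_eq_sum_range (fun k => rulL i k * rulL j k)] at this
    simp only [A, Matrix.transpose_apply, Matrix.of_apply]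
    rw [this]
    simp [hankelMatrix, rulL, rulF, add_assoc, add_comm 1]
  have h := RingHom.map_det (Int.castRingHom (ZMod 2)) (hankelMatrix n 1 ruler)
  rw [RingHom.mapMatrix_apply, hH, Matrix.det_mul, Matrix.det_transpose, hA] at h
  simpa using h
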